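/- Define p(n) = 1 if n is odd, p(n) = 2 if n is divisible by four, and p(n) = 4 if n ≡ 2 (mod 4). Let G be a complete, infinite, edge-colored graph such that spec(G) − 2 = {m − 2 : m ∈ spec(G)} is closed under addition, and suppose n ∈ spec(G) for some n > 2. Then Per(spec(G) − 2) is nonempty and per(spec(G) − 2) divides p(n). -/

import Mathlib

/-- A rainbow `m`-cycle in the complete graph on `V` edge-colored by `γ`:
pairwise distinct vertices `v i` (`i` mod `m`) with pairwise distinct edge colors
`γ (v i) (v (i+1))`. -/
def RainbowCycle {V C : Type*} (γ : V → V → C) (m : ℕ) (v : ZMod m → V) : Prop :=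
  Function.Injective v ∧ Function.Injective (fun i : ZMod m => γ (v i) (v (i + 1)))

/-- `spec(G)` for the complete graph on `V` edge-colored by `γ`:
the set of `n ≥ 2` such that no `n`-cycle is rainbow. -/
def spec {V C : Type*} (γ : V → V → C) : Set ℕ :=
  {n | 2 ≤ n ∧ ∀ v : ZMod n → V, ¬ RainbowCycle γ n v}

/-- `Per(A) = {m - n : m, n ∈ A, n < m}`. -/
def PerSet (A : Set ℕ) : Set ℕ := {p | ∃ m ∈ A, ∃ n ∈ A, n < m ∧ p = m - n}

/-- A closed walk on distinct vertices of forbidden length repeats a color. -/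
lemma nonrainbow {V C : Type*} (γ : V → V → C) (n : ℕ) (hn : n ∈ spec γ) (w : ℕ → V)
    (hinj : ∀ i j, i < j → j < n → w i ≠ w j) (hclose : w n = w 0) :
    ∃ i j, i < j ∧ j < n ∧ γ (w i) (w (i + 1)) = γ (w j) (w (j + 1)) := by
  obtain ⟨h2, hr⟩ := hn
  have : NeZero n := ⟨by omega⟩
  have : Fact (1 < n) := ⟨by omega⟩
  have hstep : ∀ z : ZMod n, w ((z + 1).val) = w (z.val + 1) := by
    intro z
    have hz := ZMod.val_lt z
    rw [ZMod.val_add, ZMod.val_one]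
    by_cases h : z.val + 1 < n
    · rw [Nat.mod_eq_of_lt h]
    · have h' : z.val + 1 = n := by omega
      rw [h', Nat.mod_self, hclose]
  by_contra hcon
  push Not at hcon
  refine hr (fun z => w z.val) ⟨?_, ?_⟩
  · intro x y hxy
    apply ZMod.val_injective n
    have hx := ZMod.val_lt x
    have hy := ZMod.val_lt y
    rcases lt_trichotomy x.val y.val with h | h | h
    · exact absurd hxy (hinj _ _ h hy)
    · exact h
    · exact absurd hxy.symm (hinj _ _ h hx)
  · intro x y hxy
    apply ZMod.val_injective n
    have hx := ZMod.val_lt x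
    have hy := ZMod.val_lt y
    simp only [hstep] at hxy
    rcases lt_trichotomy x.val y.val with h | h | h
    · exact absurd hxy (hcon _ _ h hy)
    · exact h
    · exact absurd hxy.symm (hcon _ _ h hx)

/-- A rainbow `N`-cycle, unrolled to a periodic function on the integers. -/
structure Unrolled {V C : Type*} (γ : V → V → C) (N : ℤ) (v : ℤ → V) : Prop where
  per : ∀ x, v (x + N) = v x
  inj : ∀ x y, v x = v y → x - y < N → y - x < N → x = y
  cinj : ∀ x y, γ (v x) (v (x + 1)) = γ (v y) (v (y + 1)) → x - y < N → y - x < N → x = y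

lemma unroll {V C : Type*} (γ : V → V → C) (m : ℕ) (hm : 2 ≤ m) (h : m ∉ spec γ) :
    ∃ v : ℤ → V, Unrolled γ m v := by
  have h' : ∃ v : ZMod m → V, RainbowCycle γ m v := by
    by_contra hc
    push Not at hc
    exact h ⟨hm, hc⟩
  obtain ⟨v, hv, hc⟩ := h'
  have key : ∀ x y : ℤ, (x : ZMod m) = (y : ZMod m) → x - y < m → y - x < m → x = y := by
    intro x y hxy h1 h2
    rw [ZMod.intCast_eq_intCast_iff_dvd_sub] at hxy
    obtain ⟨k, hk⟩ := hxy
    have hm' : (2 : ℤ) ≤ m := by exact_mod_cast hm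
    have : k = 0 := by
      by_contra hk0
      rcases lt_or_gt_of_ne hk0 with h | h
      · nlinarith
      · nlinarith
    subst this
    linarith
  refine ⟨fun x => v (x : ZMod m), ⟨?_, ?_, ?_⟩⟩
  · intro x; simp
  · intro x y hxy h1 h2
    exact key x y (hv hxy) h1 h2
  · intro x y hxy h1 h2
    refine key x y (hc ?_) h1 h2
    simpa using hxy

section core
variable {V C : Type*} {γ : V → V → C} {v : ℤ → V} {L : ℕ}

/-- Chords cutting off `2L+2` vertices repeat a color of the arc. -/
lemma chord (hsymm : ∀ x y, γ x y = γ y x) (hL : 2 ≤ L) (hU : Unrolled γ (6 * L - 2) v)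
    (hS : 2 * L + 2 ∈ spec γ) (i : ℤ) :
    ∃ d : ℤ, 0 ≤ d ∧ d ≤ 2 * L ∧
      γ (v i) (v (i + (2 * L + 1))) = γ (v (i + d)) (v (i + d + 1)) := by
  set g : ℕ → ℤ := fun k => if k ≤ 2 * L + 1 then i + k else i with hg
  obtain ⟨a, b, hab, hb, he⟩ := nonrainbow γ _ hS (fun k => v (g k))
    (by
      intro a b hab hb h
      have := hU.inj _ _ h (by grind) (by grind)
      grind) (by simp [hg])
  have ea : g a = i + a := by grind
  have ea' : g (a + 1) = i + a + 1 := by grind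
  have eb : g b = i + b := by grind
  simp only [ea, ea', eb] at he
  by_cases hb' : b ≤ 2 * L
  · have eb' : g (b + 1) = i + b + 1 := by grind
    rw [eb'] at he
    have := hU.cinj _ _ he (by omega) (by omega)
    omega
  · have eb' : g (b + 1) = i := by grind
    have hbb : b = 2 * L + 1 := by omega
    rw [eb'] at he
    refine ⟨a, by omega, by omega, ?_⟩
    rw [he, hsymm]
    subst hbb
    push_cast
    rfl

/-- Two crossing chords. -/
lemma crossing (hsymm : ∀ x y, γ x y = γ y x) (hL : 2 ≤ L) (hU : Unrolled γ (6 * L - 2) v)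
    (hS : 2 * L + 2 ∈ spec γ) (i d d' : ℤ) (hd0 : 0 ≤ d) (hd1 : d ≤ 2 * L)
    (hd : γ (v i) (v (i + (2 * L + 1))) = γ (v (i + d)) (v (i + d + 1)))
    (hd0' : 0 ≤ d') (hd1' : d' ≤ 2 * L)
    (hd' : γ (v (i + (2 * L - 1))) (v (i + (2 * L - 1) + (2 * L + 1))) =
      γ (v (i + (2 * L - 1) + d')) (v (i + (2 * L - 1) + d' + 1))) :
    2 * L - 1 ≤ d ∨ d' ≤ 1 := by
  by_contra hcon
  push Not at hcon
  set g : ℕ → ℤ := fun k => if k = 0 then i else if k ≤ 3 then i + 2 * L + 2 - k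
    else i + 4 * L - 4 + k with hg
  set c : ℕ → ℤ := fun k => if k = 0 then i + d else if k ≤ 2 then i + 2 * L + 1 - k
    else if k = 3 then i + (2 * L - 1) + d' else i + 4 * L - 4 + k with hc
  have hclose : v (g (2 * L + 2)) = v (g 0) := by
    have e1 : g (2 * L + 2) = i + (6 * L - 2) := by simp only [hg]; grind
    have e2 : g 0 = i := by simp [hg]
    rw [e1, e2, hU.per]
  have hcol : ∀ k < 2 * L + 2, γ (v (g k)) (v (g (k + 1))) = γ (v (c k)) (v (c k + 1)) := by
    intro k hk
    by_cases h0 : k = 0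
    · subst h0
      have e1 : g 0 = i := by simp [hg]
      have e2 : g (0 + 1) = i + (2 * L + 1) := by simp only [hg]; grind
      have e3 : c 0 = i + d := by simp [hc]
      rw [e1, e2, e3, hd]
    by_cases h3 : k = 3
    · subst h3
      have e1 : g 3 = i + (2 * L - 1) := by simp only [hg]; grind
      have e2 : g (3 + 1) = i + (2 * L - 1) + (2 * L + 1) := by simp only [hg]; grind
      have e3 : c 3 = i + (2 * L - 1) + d' := by simp [hc]
      rw [e1, e2, e3, hd']
    by_cases h4 : k ≤ 2
    · have e1 : g k = c k + 1 := by simp only [hg, hc]; grind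
      have e2 : g (k + 1) = c k := by simp only [hg, hc]; grind
      rw [e1, e2, hsymm]
    · have e1 : g k = c k := by simp only [hg, hc]; grind
      have e2 : g (k + 1) = c k + 1 := by simp only [hg, hc]; grind
      rw [e1, e2]
  obtain ⟨a, b, hab, hb, he⟩ := nonrainbow γ _ hS (fun k => v (g k))
    (by
      intro a b hab hb h
      have := hU.inj _ _ h (by simp only [hg]; split_ifs <;> omega)
        (by simp only [hg]; split_ifs <;> omega)
      simp only [hg] at this
      split_ifs at this <;> omega) hclose
  simp only [hcol a (by omega), hcol b hb] at he
  have := hU.cinj _ _ he (by simp only [hc]; split_ifs <;> omega)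
    (by simp only [hc]; split_ifs <;> omega)
  simp only [hc] at this
  split_ifs at this <;> omega

/-- The long chord compared with a short chord. -/
lemma longchord (hsymm : ∀ x y, γ x y = γ y x) (hL : 2 ≤ L) (hU : Unrolled γ (6 * L - 2) v)
    (hS : 2 * L + 2 ∈ spec γ) (z : ℤ) (t : ℕ) (ht : t ≤ 2 * L) (d : ℤ)
    (hd0 : 0 ≤ d) (hd1 : d ≤ 2 * L)
    (hd : γ (v (z + t)) (v (z + t + (2 * L + 1))) = γ (v (z + t + d)) (v (z + t + d + 1))) :
    ∃ y : ℤ, γ (v z) (v (z + (4 * L + 1))) = γ (v (z + y)) (v (z + y + 1)) ∧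
      (y = t + d ∨ (0 ≤ y ∧ y < t) ∨ (t + 2 * L + 1 ≤ y ∧ y ≤ 4 * L)) := by
  set g : ℕ → ℤ := fun k => if k ≤ t then z + k else if k ≤ 2 * L + 1 then z + 2 * L + k
    else z with hg
  set c : ℕ → ℤ := fun k => if k < t then k else if k = t then t + d else 2 * L + k with hc
  have hclose : v (g (2 * L + 2)) = v (g 0) := by
    have e1 : g (2 * L + 2) = z := by simp only [hg]; grind
    have e2 : g 0 = z := by simp [hg]
    rw [e1, e2]
  have hcol : ∀ k < 2 * L + 1,
      γ (v (g k)) (v (g (k + 1))) = γ (v (z + c k)) (v (z + c k + 1)) := by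
    intro k hk
    by_cases h0 : k = t
    · have e1 : g k = z + t := by simp only [hg]; grind
      have e2 : g (k + 1) = z + t + (2 * L + 1) := by simp only [hg]; grind
      have e3 : z + c k = z + t + d := by simp only [hc]; grind
      rw [e1, e2, e3, hd]
    · have e1 : g k = z + c k := by simp only [hg, hc]; grind
      have e2 : g (k + 1) = z + c k + 1 := by simp only [hg, hc]; grind
      rw [e1, e2]
  obtain ⟨a, b, hab, hb, he⟩ := nonrainbow γ _ hS (fun k => v (g k))
    (by
      intro a b hab hb h
      have := hU.inj _ _ h (by simp only [hg]; split_ifs <;> omega)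
        (by simp only [hg]; split_ifs <;> omega)
      simp only [hg] at this
      split_ifs at this <;> omega) hclose
  simp only [hcol a (by omega)] at he
  by_cases hb' : b < 2 * L + 1
  · exfalso
    simp only [hcol b hb'] at he
    have := hU.cinj _ _ he (by simp only [hc]; split_ifs <;> omega)
      (by simp only [hc]; split_ifs <;> omega)
    simp only [hc] at this
    split_ifs at this <;> omega
  · have hbb : b = 2 * L + 1 := by omega
    have e1 : g b = z + (4 * L + 1) := by simp only [hg]; grind
    have e2 : g (b + 1) = z := by simp only [hg]; grind
    rw [e1, e2, hsymm (v (z + (4 * L + 1)))] at he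
    refine ⟨c a, he.symm, ?_⟩
    simp only [hc]
    split_ifs <;> omega

set_option maxHeartbeats 4000000 in
/-- All chords take one of the first two colors of their arc: contradiction. -/
lemma allLow (hsymm : ∀ x y, γ x y = γ y x) (M : ℕ) (hM : 2 ≤ M) (hLM : L = 2 * M)
    (hU : Unrolled γ (6 * L - 2) v) (hS : 2 * L + 2 ∈ spec γ)
    (hlow : ∀ i, ∃ d : ℤ, 0 ≤ d ∧ d ≤ 1 ∧
      γ (v i) (v (i + (2 * L + 1))) = γ (v (i + d)) (v (i + d + 1))) : False := by
  have hL : 2 ≤ L := by omega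
  choose d hd0 hd1 hd using hlow
  have hlong : ∀ z, γ (v z) (v (z + (4 * L + 1))) = γ (v (z + d z)) (v (z + d z + 1)) := by
    intro z
    obtain ⟨y, hy, h⟩ := longchord hsymm hL hU hS z 0 (by omega) (d z) (hd0 z)
      (by have := hd1 z; omega) (by simpa using hd z)
    by_cases hyd : y = d z
    · rw [hy, hyd]
    exfalso
    have hy1 : 2 * L + 1 ≤ y ∧ y ≤ 4 * L := by
      rcases h with h | h | h
      · simp at h; exact absurd h hyd
      · simp at h; omega
      · simpa using h
    obtain ⟨t, ht⟩ := Int.eq_ofNat_of_zero_le (show 0 ≤ y - 2 * L by omega)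
    obtain ⟨y', hy', h'⟩ := longchord hsymm hL hU hS z t (by omega) (d (z + t)) (hd0 _)
      (by have := hd1 (z + t); omega) (hd _)
    rw [hy] at hy'
    have a1 := hd0 (z + t)
    have a2 := hd1 (z + t)
    have := hU.cinj _ _ hy' (by omega) (by omega)
    omega
  set g : ℕ → ℤ := fun k =>
    if k < L then (if k % 2 = 0 then 2 * k else 2 * k + 2 * L - 1)
    else if k < L + 3 then 3 * L - 2 + k
    else if 2 * L < k then 4 * L - 4 + k
    else (if k % 2 = 1 then 2 * k - 3 else 2 * k + 2 * L - 4) with hg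
  have hclose : v (g (2 * L + 2)) = v (g 0) := by
    have e1 : g (2 * L + 2) = 0 + (6 * L - 2) := by simp only [hg]; split_ifs <;> omega
    have e2 : g 0 = 0 := by simp only [hg]; split_ifs <;> omega
    rw [e1, e2, hU.per]
  have hcol : ∀ k < 2 * L + 2, ∃ δ : ℤ, 0 ≤ δ ∧ δ ≤ 1 ∧
      (δ = 1 → ¬ (k = L - 1 ∨ k = L ∨ k = L + 1 ∨ k = 2 * L ∨ k = 2 * L + 1)) ∧
      γ (v (g k)) (v (g (k + 1))) = γ (v (g k + δ)) (v (g k + δ + 1)) := by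
    intro k hk
    by_cases hE : k = L - 1 ∨ k = L ∨ k = L + 1 ∨ k = 2 * L ∨ k = 2 * L + 1
    · refine ⟨0, by omega, by omega, by omega, ?_⟩
      have e : g (k + 1) = g k + 0 + 1 := by simp only [hg]; split_ifs <;> omega
      rw [e, add_zero]
    · refine ⟨d (g k), hd0 _, hd1 _, fun _ => hE, ?_⟩
      by_cases hJ : (k < L ∧ k % 2 = 0) ∨ (L + 3 ≤ k ∧ k % 2 = 1)
      · have e : g (k + 1) = g k + (2 * L + 1) := by
          simp only [hg]; split_ifs <;> omega
        rw [e, hd]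
      · have e : g (k + 1) + (6 * L - 2) = g k + (4 * L + 1) := by
          simp only [hg]; split_ifs <;> omega
        rw [← hU.per (g (k + 1)), e, hlong]
  obtain ⟨a, b, hab, hb, he⟩ := nonrainbow γ _ hS (fun k => v (g k))
    (by
      intro a b hab hb h
      have := hU.inj _ _ h (by simp only [hg]; split_ifs <;> omega)
        (by simp only [hg]; split_ifs <;> omega)
      simp only [hg] at this
      split_ifs at this <;> omega) hclose
  obtain ⟨δ, p0, p1, p2, p3⟩ := hcol a (by omega)
  obtain ⟨ε, q0, q1, q2, q3⟩ := hcol b hb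
  simp only [p3, q3] at he
  have hga : 0 ≤ g a ∧ g a ≤ 6 * L - 3 ∧ (δ = 1 → g a ≤ 6 * L - 4) := by
    simp only [hg]; split_ifs <;> omega
  have hgb : 0 ≤ g b ∧ g b ≤ 6 * L - 3 ∧ (ε = 1 → g b ≤ 6 * L - 4) := by
    simp only [hg]; split_ifs <;> omega
  have := hU.cinj _ _ he (by omega) (by omega)
  simp only [hg] at this
  split_ifs at this <;> omega

lemma key (hsymm : ∀ x y, γ x y = γ y x) (M : ℕ) (hM : 2 ≤ M) (hLM : L = 2 * M)
    (hU : Unrolled γ (6 * L - 2) v) (hS : 2 * L + 2 ∈ spec γ) : False := by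
  have hL : 2 ≤ L := by omega
  choose d hd0 hd1 hd using chord hsymm hL hU hS
  have hX : ∀ i, 2 * L - 1 ≤ d i ∨ d (i + (2 * L - 1)) ≤ 1 := fun i =>
    crossing hsymm hL hU hS i _ _ (hd0 _) (hd1 _) (hd _) (hd0 _) (hd1 _) (hd _)
  have hper : ∀ i, d (i + (6 * L - 2)) = d i := by
    intro i
    have h1 := hd (i + (6 * L - 2))
    rw [show i + (6 * L - 2) + (2 * L + 1) = i + (2 * L + 1) + (6 * (L : ℤ) - 2) by ring,
      show i + (6 * L - 2) + d (i + (6 * L - 2)) = i + d (i + (6 * L - 2)) + (6 * (L : ℤ) - 2)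
        by ring,
      show i + d (i + (6 * L - 2)) + (6 * (L : ℤ) - 2) + 1 =
        i + d (i + (6 * L - 2)) + 1 + (6 * (L : ℤ) - 2) by ring,
      hU.per, hU.per, hU.per, hU.per, hd i] at h1
    have a1 := hd0 (i + (6 * L - 2))
    have a2 := hd1 (i + (6 * L - 2))
    have a3 := hd0 i
    have a4 := hd1 i
    have := hU.cinj _ _ h1 (by omega) (by omega)
    omega
  by_cases hH : ∀ i, 2 * L - 1 ≤ d i
  · -- reflect
    have hU' : Unrolled γ (6 * L - 2) (fun x => v (-x)) := by
      refine ⟨?_, ?_, ?_⟩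
      · intro x
        show v (-(x + _)) = v (-x)
        rw [← hU.per (-(x + (6 * L - 2)))]
        congr 1; ring
      · intro x y h h1 h2
        have := hU.inj _ _ h (by omega) (by omega)
        omega
      · intro x y h h1 h2
        have h' : γ (v (-(x + 1))) (v (-(x + 1) + 1)) = γ (v (-(y + 1))) (v (-(y + 1) + 1)) := by
          rw [hsymm, hsymm (v (-(y + 1)))]
          rw [show -(x + 1) + 1 = -x by ring, show -(y + 1) + 1 = -y by ring]
          exact h
        have := hU.cinj _ _ h' (by omega) (by omega)
        omega
    refine allLow hsymm M hM hLM hU' hS ?_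
    intro i
    have h := hd (-(i + (2 * L + 1)))
    have b1 := hH (-(i + (2 * L + 1)))
    have b2 := hd1 (-(i + (2 * L + 1)))
    refine ⟨2 * L - d (-(i + (2 * L + 1))), by omega, by omega, ?_⟩
    show γ (v (-i)) (v (-(i + (2 * L + 1)))) = _
    rw [hsymm, show -i = -(i + (2 * (L : ℤ) + 1)) + (2 * L + 1) by ring, h, hsymm]
    congr 2 <;> ring
  · push Not at hH
    obtain ⟨i, hi⟩ := hH
    have h1 : ∀ j, d j < 2 * L - 1 → d (j - 1) ≤ 1 := by
      intro j hj
      have x1 := hX j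
      have x2 := hX (j + (2 * L - 1))
      have x3 := hX (j + (2 * L - 1) + (2 * L - 1))
      rw [show j + (2 * L - 1) + (2 * L - 1) + (2 * L - 1) = j - 1 + (6 * (L : ℤ) - 2) by ring,
        hper] at x3
      omega
    have h2 : ∀ k : ℕ, d (i - 1 - k) ≤ 1 := by
      intro k
      induction k with
      | zero => simpa using h1 i hi
      | succ k ih =>
        have := h1 (i - 1 - k) (by omega)
        rw [show i - 1 - ((k + 1 : ℕ) : ℤ) = i - 1 - k - 1 by push_cast; ring]
        exact this
    have h3 : ∀ (k : ℕ) (j : ℤ), d (j - k * (6 * L - 2)) = d j := by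
      intro k
      induction k with
      | zero => intro j; simp
      | succ k ih =>
        intro j
        rw [← hper, ← ih j]
        congr 1; push_cast; ring
    refine allLow hsymm M hM hLM hU hS ?_
    intro j
    refine ⟨d j, hd0 j, ?_, hd j⟩
    rw [← h3 (j - i + 1).natAbs j]
    have hk : 0 ≤ i - 1 - (j - ((j - i + 1).natAbs : ℤ) * (6 * L - 2)) := by
      have p1 : j - i + 1 ≤ ((j - i + 1).natAbs : ℤ) := by omega
      have p2 : 0 ≤ ((j - i + 1).natAbs : ℤ) := by omega
      have p3 : (1 : ℤ) ≤ 6 * L - 2 := by omega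
      nlinarith
    obtain ⟨k, hk'⟩ := Int.eq_ofNat_of_zero_le hk
    have := h2 k
    rw [← hk'] at this
    simpa using this

end core

lemma per_dvd (A : Set ℕ) (h0 : 0 ∈ A) (hclosed : ∀ a ∈ A, ∀ b ∈ A, a + b ∈ A)
    (hne : (PerSet A).Nonempty) (x : ℕ) (hx : x ∈ A) : sInf (PerSet A) ∣ x := by
  have hmul : ∀ t : ℕ, ∀ a ∈ A, t * a ∈ A := by
    intro t a ha
    induction t with
    | zero => simpa using h0
    | succ t ih => rw [Nat.succ_mul]; exact hclosed _ ih _ ha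
  obtain ⟨m, hm, k, hk, hkm, hq⟩ := Nat.sInf_mem hne
  set q := sInf (PerSet A) with hqd
  by_contra hnd
  have hr : 0 < x % q := Nat.pos_of_ne_zero fun h => hnd (Nat.dvd_of_mod_eq_zero h)
  have hlt : x % q < q := Nat.mod_lt _ (by omega)
  have hdm := Nat.div_add_mod x q
  have e : x / q * m = q * (x / q) + x / q * k := by
    have : m = q + k := by omega
    conv_lhs => rw [this]
    ring
  have : x % q ∈ PerSet A :=
    ⟨x + x / q * k, hclosed _ hx _ (hmul _ _ hk), x / q * m, hmul _ _ hm, by omega, by omega⟩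
  exact absurd (Nat.sInf_le this) (by omega)

/-- Let `p(n) = 1` for odd `n`, `p(n) = 2` for `4 ∣ n`, `p(n) = 4` for
`n ≡ 2 (mod 4)`. If `G` is complete, infinite, edge-colored, `spec(G) - 2` is closed
under addition, and `n ∈ spec(G)` with `n > 2`, then `Per(spec(G) - 2)` is nonempty and
`per(spec(G) - 2)` divides `p(n)`. -/
theorem stmt16 {V C : Type*} [Infinite V] (γ : V → V → C) (hsymm : ∀ x y, γ x y = γ y x)
    (p : ℕ → ℕ) (hp : ∀ m, p m = if Odd m then 1 else if 4 ∣ m then 2 else 4)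
    (A : Set ℕ) (hA : A = (fun m => m - 2) '' spec γ)
    (hclosed : ∀ a ∈ A, ∀ b ∈ A, a + b ∈ A)
    (n : ℕ) (hn : n ∈ spec γ) (h2 : 2 < n) :
    (PerSet A).Nonempty ∧ sInf (PerSet A) ∣ p n := by
  have h2s : 2 ∈ spec γ := by
    refine ⟨le_rfl, fun v hv => ?_⟩
    have := hv.2 (a₁ := 0) (a₂ := 1) (by
      show γ (v 0) (v (0 + 1)) = γ (v 1) (v (1 + 1))
      rw [show (1 + 1 : ZMod 2) = 0 by decide, zero_add, hsymm])
    exact absurd this (by decide)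
  have h0 : 0 ∈ A := by rw [hA]; exact ⟨2, h2s, rfl⟩
  have ha : n - 2 ∈ A := by rw [hA]; exact ⟨n, hn, rfl⟩
  have hne : (PerSet A).Nonempty := ⟨n - 2 - 0, n - 2, ha, 0, h0, by omega, rfl⟩
  refine ⟨hne, ?_⟩
  have hmul : ∀ t : ℕ, t * (n - 2) ∈ A := by
    intro t
    induction t with
    | zero => simpa using h0
    | succ t ih => rw [Nat.succ_mul]; exact hclosed _ ih _ ha
  have hback : ∀ x, x ∈ A → x + 2 ∈ spec γ := by
    intro x hx
    rw [hA] at hx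
    obtain ⟨m, hm, rfl⟩ := hx
    have := hm.1
    simpa [Nat.sub_add_cancel this] using hm
  have hS : 2 * (4 * (n - 2)) + 2 ∈ spec γ := by
    have := hback _ (hmul 8)
    rwa [show 8 * (n - 2) = 2 * (4 * (n - 2)) by ring] at this
  have hN : 6 * (4 * (n - 2)) - 2 ∈ spec γ := by
    by_contra hc
    obtain ⟨v, hv⟩ := unroll γ _ (by omega) hc
    refine key (L := 4 * (n - 2)) (v := v) hsymm (2 * (n - 2)) (by omega) (by ring) ?_ hS
    have e : ((6 * (4 * (n - 2)) - 2 : ℕ) : ℤ) = 6 * ((4 * (n - 2) : ℕ) : ℤ) - 2 := by omega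
    rwa [e] at hv
  have hb : 6 * (4 * (n - 2)) - 4 ∈ A := by
    rw [hA]; exact ⟨_, hN, by simp; omega⟩
  have d1 := per_dvd A h0 hclosed hne _ ha
  have d2 := per_dvd A h0 hclosed hne _ hb
  generalize sInf (PerSet A) = q at d1 d2
  have d4 : q ∣ 4 := by
    have h := Nat.dvd_sub (Dvd.dvd.mul_left d1 24) d2
    rwa [show 24 * (n - 2) - (6 * (4 * (n - 2)) - 4) = 4 by omega] at h
  rw [hp]
  have hq : q ≤ 4 := Nat.le_of_dvd (by norm_num) d4
  split_ifs with ho h4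
  · obtain ⟨k, hk⟩ := ho
    interval_cases q <;> omega
  · interval_cases q <;> omega
  · exact d4
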